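/- arXiv:2401.04966 — 7 statements merged into one kernel-verified Lean document; each statement's English description precedes it below -/
import Mathlib

section
/- Let E be a real Banach space, u : ℝ → E five times continuously differentiable, and tₙ ∈ ℝ. For h > 0 set f₁(h) = (u(tₙ+h) − u(tₙ) − h·u′(tₙ))/h², f₂(h) = (u′(tₙ) − u′(tₙ−h))/h, and f₃(h) = (u′(tₙ−h) − u′(tₙ−2h))/h. Then there exist constants C > 0 and h₀ > 0 such that for all 0 < h ≤ h₀, ‖(8/9)·f₁(h) + (37/54)·f₂(h) − (7/54)·f₃(h) − u″(tₙ)‖ ≤ C·h³. -/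
open Asymptotics in
/-- Two-sided Taylor bound with a local uniform constant: the Taylor polynomial of degree `n` of
a `C^(n+1)` function approximates it to order `n + 1`. -/
theorem exists_norm_sub_taylor_sum_le {E : Type*} [NormedAddCommGroup E] [NormedSpace ℝ E]
    {f : ℝ → E} {n : ℕ} (hf : ContDiff ℝ (n + 1 : ℕ) f) (x₀ : ℝ) :
    ∃ C > (0 : ℝ), ∃ δ > (0 : ℝ), ∀ h : ℝ, |h| ≤ δ →
      ‖f (x₀ + h) - ∑ k ∈ Finset.range (n + 1), ((k.factorial : ℝ)⁻¹ * h ^ k) •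
        iteratedDeriv k f x₀‖ ≤ C * |h| ^ (n + 1) := by
  have hO : (fun x => f x - taylorWithinEval f n Set.univ x₀ x) =O[nhds x₀]
      fun x => (x - x₀) ^ (n + 1) := by
    have h_last : (fun x => (((n + 1 : ℝ) * n.factorial)⁻¹ * (x - x₀) ^ (n + 1)) •
        iteratedDerivWithin (n + 1) f Set.univ x₀) =O[nhds x₀] fun x => (x - x₀) ^ (n + 1) := by
      refine IsBigO.of_bound
        (‖((n + 1 : ℝ) * n.factorial)⁻¹‖ * ‖iteratedDerivWithin (n + 1) f Set.univ x₀‖)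
        (Filter.Eventually.of_forall fun x => ?_)
      rw [norm_smul, norm_mul]
      exact le_of_eq (by ring)
    refine ((taylor_isLittleO_univ hf).isBigO.add h_last).congr_left fun x => ?_
    rw [taylorWithinEval_succ]
    abel
  obtain ⟨C, hC, hb⟩ := hO.exists_pos
  obtain ⟨δ, hδ, hball⟩ := Metric.eventually_nhds_iff.1 hb.bound
  refine ⟨C, hC, δ / 2, half_pos hδ, fun h hh => ?_⟩
  have key := hball (y := x₀ + h) (by rw [Real.dist_eq, add_sub_cancel_left]; linarith)
  simpa [taylor_within_apply, iteratedDerivWithin_univ] using key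

/-- Recovery of the second derivative in the fourth-order MTS scheme:
`(8/9)f₁ + (37/54)f₂ − (7/54)f₃ = u″(tₙ) + O(h³)`, where
`f₁ = (u(tₙ+h) − u(tₙ) − h·u′(tₙ))/h²`, `f₂ = (u′(tₙ) − u′(tₙ−h))/h`,
`f₃ = (u′(tₙ−h) − u′(tₙ−2h))/h`. -/
theorem mts_recover_second_deriv {E : Type*} [NormedAddCommGroup E] [NormedSpace ℝ E]
    [CompleteSpace E] (u : ℝ → E) (hu : ContDiff ℝ 5 u) (tn : ℝ) :
    ∃ C > (0 : ℝ), ∃ h₀ > (0 : ℝ), ∀ h : ℝ, 0 < h → h ≤ h₀ →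
      ‖((8 : ℝ) / 9) • ((h ^ 2)⁻¹ • (u (tn + h) - u tn - h • deriv u tn)) +
          ((37 : ℝ) / 54) • (h⁻¹ • (deriv u tn - deriv u (tn - h))) -
          ((7 : ℝ) / 54) • (h⁻¹ • (deriv u (tn - h) - deriv u (tn - 2 * h))) -
          iteratedDeriv 2 u tn‖ ≤ C * h ^ 3 := by
  obtain ⟨A, hA, a, ha, hR⟩ := exists_norm_sub_taylor_sum_le (n := 4) hu tn
  have hu' : ContDiff ℝ (3 + 1 : ℕ) (deriv u) := ContDiff.iterate_deriv' 4 1 hu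
  obtain ⟨B, hB, b, hb, hS⟩ := exists_norm_sub_taylor_sum_le hu' tn
  refine ⟨8 / 9 * A + 44 / 54 * B + 112 / 54 * B, by positivity, min a (b / 2),
    by positivity, fun h hpos hle => ?_⟩
  have hha : h ≤ a := hle.trans (min_le_left _ _)
  have hhb : h ≤ b / 2 := hle.trans (min_le_right _ _)
  have r := hR h (by rwa [abs_of_pos hpos])
  have s₁ := hS (-h) (by rw [abs_neg, abs_of_pos hpos]; linarith)
  have s₂ := hS (-(2 * h)) (by rw [abs_neg, abs_of_pos (by positivity)]; linarith)
  rw [abs_of_pos hpos] at r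
  rw [abs_neg, abs_of_pos hpos, ← sub_eq_add_neg] at s₁
  rw [abs_neg, abs_of_pos (by positivity), ← sub_eq_add_neg] at s₂
  simp only [← iteratedDeriv_succ'] at s₁ s₂
  simp only [Finset.sum_range_succ, Finset.sum_range_zero, zero_add, Nat.reduceAdd,
    iteratedDeriv_zero, iteratedDeriv_one, Nat.factorial, Nat.succ_eq_add_one, Nat.reduceMul]
    at r s₁ s₂
  set R := u (tn + h) - (_ + _) with hRdef
  set S₁ := deriv u (tn - h) - (_ + _) with hS₁def
  set S₂ := deriv u (tn - 2 * h) - (_ + _) with hS₂def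
  have key : ((8 : ℝ) / 9) • ((h ^ 2)⁻¹ • (u (tn + h) - u tn - h • deriv u tn)) +
      ((37 : ℝ) / 54) • (h⁻¹ • (deriv u tn - deriv u (tn - h))) -
      ((7 : ℝ) / 54) • (h⁻¹ • (deriv u (tn - h) - deriv u (tn - 2 * h))) -
      iteratedDeriv 2 u tn =
      ((8 : ℝ) / 9 * (h ^ 2)⁻¹) • R - ((44 : ℝ) / 54 * h⁻¹) • S₁ + ((7 : ℝ) / 54 * h⁻¹) • S₂ := by
    rw [hRdef, hS₁def, hS₂def]
    match_scalars <;> field_simp <;> ring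
  rw [key]
  calc _ ≤ 8 / 9 * (h ^ 2)⁻¹ * ‖R‖ + 44 / 54 * h⁻¹ * ‖S₁‖ + 7 / 54 * h⁻¹ * ‖S₂‖ := by
        refine (norm_add_le _ _).trans (add_le_add ((norm_sub_le _ _).trans (le_of_eq ?_))
          (le_of_eq ?_))
        · rw [norm_smul_of_nonneg (by positivity), norm_smul_of_nonneg (by positivity)]
        · rw [norm_smul_of_nonneg (by positivity)]
    _ ≤ 8 / 9 * (h ^ 2)⁻¹ * (A * h ^ 5) + 44 / 54 * h⁻¹ * (B * h ^ 4) +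
        7 / 54 * h⁻¹ * (B * (2 * h) ^ 4) := by gcongr
    _ = _ := by field_simp; ring
end

section
/- Let E be a real Banach space, u : ℝ → E five times continuously differentiable, and tₙ ∈ ℝ. For h > 0 set f₁(h) = (u(tₙ+h) − u(tₙ) − h·u′(tₙ))/h², f₂(h) = (u′(tₙ) − u′(tₙ−h))/h, and f₃(h) = (u′(tₙ−h) − u′(tₙ−2h))/h. Then there exist constants C > 0 and h₀ > 0 such that for all 0 < h ≤ h₀, ‖(8/(3h))·f₁(h) − (13/(9h))·f₂(h) + (1/(9h))·f₃(h) − u‴(tₙ)‖ ≤ C·h². -/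
open Asymptotics Topology in
/-- Big-O form of Taylor's theorem along a line through `t`. -/
theorem ContDiff.sub_taylor_isBigO {E : Type*} [NormedAddCommGroup E] [NormedSpace ℝ E]
    {f : ℝ → E} {n : ℕ} (hf : ContDiff ℝ (n + 1 : ℕ) f) (t c : ℝ) :
    (fun h : ℝ => f (t + c * h) -
      ∑ k ∈ Finset.range (n + 1), ((k.factorial : ℝ)⁻¹ * (c * h) ^ k) • iteratedDeriv k f t)
      =O[𝓝 0] fun h : ℝ => h ^ (n + 1) := by
  have hbig : (fun x : ℝ => f x - taylorWithinEval f n Set.univ t x)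
      =O[𝓝 t] fun x : ℝ => (x - t) ^ (n + 1) := by
    have hlast : (fun x : ℝ => (((n + 1 : ℝ) * n.factorial)⁻¹ * (x - t) ^ (n + 1)) •
        iteratedDerivWithin (n + 1) f Set.univ t) =O[𝓝 t] fun x : ℝ => (x - t) ^ (n + 1) := by
      refine IsBigO.of_bound
        (‖((n + 1 : ℝ) * n.factorial)⁻¹‖ * ‖iteratedDerivWithin (n + 1) f Set.univ t‖)
        (Filter.Eventually.of_forall fun x => ?_)
      rw [norm_smul, norm_mul]
      exact le_of_eq (by ring)
    refine ((taylor_isLittleO_univ hf).isBigO.add hlast).congr_left fun x => ?_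
    rw [taylorWithinEval_succ]
    abel
  have hlim : Filter.Tendsto (fun h : ℝ => t + c * h) (𝓝 0) (𝓝 t) := by
    have : Continuous fun h : ℝ => t + c * h := by fun_prop
    simpa using this.tendsto 0
  have hcomp := hbig.comp_tendsto hlim
  refine (hcomp.congr_left fun h => ?_).trans (IsBigO.of_bound (‖c ^ (n + 1)‖)
    (Filter.Eventually.of_forall fun h => ?_))
  · simp [taylor_within_apply, iteratedDerivWithin_univ]
  · simp [mul_pow]

/-- Recovery of the third derivative in the fourth-order MTS scheme:
`(8/(3h))f₁ − (13/(9h))f₂ + (1/(9h))f₃ = u‴(tₙ) + O(h²)`, where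
`f₁ = (u(tₙ+h) − u(tₙ) − h·u′(tₙ))/h²`, `f₂ = (u′(tₙ) − u′(tₙ−h))/h`,
`f₃ = (u′(tₙ−h) − u′(tₙ−2h))/h`. -/
theorem mts_recover_third_deriv {E : Type*} [NormedAddCommGroup E] [NormedSpace ℝ E]
    [CompleteSpace E] (u : ℝ → E) (hu : ContDiff ℝ 5 u) (tn : ℝ) :
    ∃ C > (0 : ℝ), ∃ h₀ > (0 : ℝ), ∀ h : ℝ, 0 < h → h ≤ h₀ →
      ‖(8 / (3 * h)) • ((h ^ 2)⁻¹ • (u (tn + h) - u tn - h • deriv u tn)) -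
          (13 / (9 * h)) • (h⁻¹ • (deriv u tn - deriv u (tn - h))) +
          (1 / (9 * h)) • (h⁻¹ • (deriv u (tn - h) - deriv u (tn - 2 * h))) -
          iteratedDeriv 3 u tn‖ ≤ C * h ^ 2 := by
  have hu' : ContDiff ℝ (3 + 1 : ℕ) (deriv u) := by
    have h5 : ContDiff ℝ (4 + 1) u := by
      convert hu using 1
      norm_num
    exact_mod_cast (contDiff_succ_iff_deriv.1 h5).2.2
  have e₁ := ContDiff.sub_taylor_isBigO (n := 4) (by exact_mod_cast hu) tn 1
  have e₂ := hu'.sub_taylor_isBigO tn (-1)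
  have e₃ := hu'.sub_taylor_isBigO tn (-2)
  obtain ⟨C₁, hC₁, b₁⟩ := e₁.exists_pos
  obtain ⟨C₂, hC₂, b₂⟩ := e₂.exists_pos
  obtain ⟨C₃, hC₃, b₃⟩ := e₃.exists_pos
  obtain ⟨ε, hε, hball⟩ := Metric.eventually_nhds_iff.1 (b₁.bound.and (b₂.bound.and b₃.bound))
  refine ⟨8 / 3 * C₁ + 14 / 9 * C₂ + 1 / 9 * C₃, by positivity, ε / 2, by positivity,
    fun h hpos hle => ?_⟩
  have hdist : dist h 0 < ε := by
    rw [Real.dist_eq, sub_zero, abs_of_pos hpos]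
    linarith
  obtain ⟨r₁, r₂, r₃⟩ := hball hdist
  simp only [Finset.sum_range_succ, Finset.sum_range_zero, ← iteratedDeriv_succ',
    Real.norm_of_nonneg (pow_nonneg hpos.le _), Nat.reduceAdd] at r₁ r₂ r₃
  simp only [← iteratedDeriv_one]
  rw [show tn + 1 * h = tn + h by ring] at r₁
  rw [show tn + -1 * h = tn - h by ring] at r₂
  rw [show tn + -2 * h = tn - 2 * h by ring] at r₃
  simp only [← iteratedDeriv_one] at r₂ r₃
  simp only [iteratedDeriv_zero] at r₁
  generalize hR₁ : u (tn + h) - _ = R₁ at r₁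
  generalize hR₂ : iteratedDeriv 1 u (tn - h) - _ = R₂ at r₂
  generalize hR₃ : iteratedDeriv 1 u (tn - 2 * h) - _ = R₃ at r₃
  have key : (8 / (3 * h)) • ((h ^ 2)⁻¹ • (u (tn + h) - u tn - h • iteratedDeriv 1 u tn)) -
      (13 / (9 * h)) • (h⁻¹ • (iteratedDeriv 1 u tn - iteratedDeriv 1 u (tn - h))) +
      (1 / (9 * h)) • (h⁻¹ • (iteratedDeriv 1 u (tn - h) - iteratedDeriv 1 u (tn - 2 * h))) -
      iteratedDeriv 3 u tn =
      (8 / 3 / h ^ 3) • R₁ + (14 / 9 / h ^ 2) • R₂ - (1 / 9 / h ^ 2) • R₃ := by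
    rw [← hR₁, ← hR₂, ← hR₃]
    norm_num [Nat.factorial]
    match_scalars <;> field_simp <;> ring
  rw [key]
  calc _ ≤ ‖(8 / 3 / h ^ 3) • R₁‖ + ‖(14 / 9 / h ^ 2) • R₂‖ + ‖(1 / 9 / h ^ 2) • R₃‖ :=
        (norm_sub_le _ _).trans (by gcongr; exact norm_add_le _ _)
    _ = 8 / 3 / h ^ 3 * ‖R₁‖ + 14 / 9 / h ^ 2 * ‖R₂‖ + 1 / 9 / h ^ 2 * ‖R₃‖ := by
        simp only [norm_smul]
        rw [Real.norm_of_nonneg (by positivity), Real.norm_of_nonneg (by positivity),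
          Real.norm_of_nonneg (by positivity)]
    _ ≤ 8 / 3 / h ^ 3 * (C₁ * h ^ 5) + 14 / 9 / h ^ 2 * (C₂ * h ^ 4) +
        1 / 9 / h ^ 2 * (C₃ * h ^ 4) := by gcongr
    _ = _ := by field_simp
end

section
/- Let E be a real Banach space, u : ℝ → E four times continuously differentiable, and tₙ ∈ ℝ. For h > 0 set f₁(h) = (u(tₙ+h) − u(tₙ) − h·u′(tₙ))/h² and f₂(h) = (u′(tₙ) − u′(tₙ−h))/h. Then there exist constants C > 0 and h₀ > 0 such that for all 0 < h ≤ h₀, both ‖(6/5)·f₁(h) + (2/5)·f₂(h) − u″(tₙ)‖ ≤ C·h² and ‖(12/(5h))·f₁(h) − (6/(5h))·f₂(h) − u‴(tₙ)‖ ≤ C·h. -/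
open Asymptotics Topology in
/-- Taylor's formula with an explicit big-O remainder, one order below the smoothness. -/
theorem taylorWithinEval_sub_isBigO_pow {E : Type*} [NormedAddCommGroup E] [NormedSpace ℝ E]
    {f : ℝ → E} {n : ℕ} (hf : ContDiff ℝ (n + 1 : ℕ) f) (x₀ : ℝ) :
    (fun x => f x - taylorWithinEval f n Set.univ x₀ x) =O[𝓝 x₀]
      fun x => (x - x₀) ^ (n + 1) := by
  have hlast : (fun x => (((n + 1 : ℝ) * n.factorial)⁻¹ * (x - x₀) ^ (n + 1)) •
      iteratedDerivWithin (n + 1) f Set.univ x₀) =O[𝓝 x₀] fun x => (x - x₀) ^ (n + 1) := by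
    refine IsBigO.of_bound (‖((n + 1 : ℝ) * n.factorial)⁻¹‖ *
      ‖iteratedDerivWithin (n + 1) f Set.univ x₀‖) (Filter.Eventually.of_forall fun x => ?_)
    rw [norm_smul, norm_mul]
    exact le_of_eq (by ring)
  refine ((taylor_isLittleO_univ (x₀ := x₀) hf).isBigO.add hlast).congr_left fun x => ?_
  rw [taylorWithinEval_succ]
  abel

open Topology in
/-- A bound on the Taylor remainder, valid for all small increments of either sign. -/
theorem exists_norm_sub_taylorWithinEval_le {E : Type*} [NormedAddCommGroup E]
    [NormedSpace ℝ E] {f : ℝ → E} {n : ℕ} (hf : ContDiff ℝ (n + 1 : ℕ) f) (x₀ : ℝ) :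
    ∃ C > (0 : ℝ), ∃ δ > (0 : ℝ), ∀ h : ℝ, |h| < δ →
      ‖f (x₀ + h) - taylorWithinEval f n Set.univ x₀ (x₀ + h)‖ ≤ C * |h| ^ (n + 1) := by
  obtain ⟨C, hC, hbound⟩ := (taylorWithinEval_sub_isBigO_pow hf x₀).exists_pos
  obtain ⟨δ, hδ, hball⟩ := Metric.eventually_nhds_iff.1 hbound.bound
  refine ⟨C, hC, δ, hδ, fun h hh => ?_⟩
  have := hball (y := x₀ + h) (by simpa [Real.dist_eq] using hh)
  simpa using this

/-- Recovery of both derivatives in the third-order MTS scheme: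
`(6/5)f₁ + (2/5)f₂ = u″(tₙ) + O(h²)` and `(12/(5h))f₁ − (6/(5h))f₂ = u‴(tₙ) + O(h)`,
where `f₁ = (u(tₙ+h) − u(tₙ) − h·u′(tₙ))/h²` and `f₂ = (u′(tₙ) − u′(tₙ−h))/h`. -/
theorem mts3_recover_derivs {E : Type*} [NormedAddCommGroup E] [NormedSpace ℝ E]
    [CompleteSpace E] (u : ℝ → E) (hu : ContDiff ℝ 4 u) (tn : ℝ) :
    ∃ C > (0 : ℝ), ∃ h₀ > (0 : ℝ), ∀ h : ℝ, 0 < h → h ≤ h₀ →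
      ‖((6 : ℝ) / 5) • ((h ^ 2)⁻¹ • (u (tn + h) - u tn - h • deriv u tn)) +
          ((2 : ℝ) / 5) • (h⁻¹ • (deriv u tn - deriv u (tn - h))) -
          iteratedDeriv 2 u tn‖ ≤ C * h ^ 2 ∧
      ‖(12 / (5 * h)) • ((h ^ 2)⁻¹ • (u (tn + h) - u tn - h • deriv u tn)) -
          (6 / (5 * h)) • (h⁻¹ • (deriv u tn - deriv u (tn - h))) -
          iteratedDeriv 3 u tn‖ ≤ C * h := by
  have hu' : ContDiff ℝ (2 + 1 : ℕ) (deriv u) := by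
    have h4 : ContDiff ℝ (3 + 1) u := by
      convert hu using 1
      norm_num
    exact_mod_cast (contDiff_succ_iff_deriv.1 h4).2.2
  obtain ⟨A, hA, δ, hδ, hAb⟩ :=
    exists_norm_sub_taylorWithinEval_le (n := 3) (by exact_mod_cast hu) tn
  obtain ⟨B, hB, ε, hε, hBb⟩ := exists_norm_sub_taylorWithinEval_le (n := 2) hu' tn
  refine ⟨12 / 5 * A + 6 / 5 * B, by positivity, min δ ε / 2, by positivity,
    fun h hpos hle => ?_⟩
  have hmin : h < min δ ε := by
    have : 0 < min δ ε := lt_min hδ hε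
    linarith
  have hR := hAb h (by rw [abs_of_pos hpos]; exact hmin.trans_le (min_le_left _ _))
  have hS := hBb (-h) (by rw [abs_neg, abs_of_pos hpos]; exact hmin.trans_le (min_le_right _ _))
  rw [abs_neg, abs_of_pos hpos] at hS
  rw [abs_of_pos hpos] at hR
  simp only [taylorWithinEval_succ, taylor_within_zero_eval, iteratedDerivWithin_univ,
    ← iteratedDeriv_succ', add_sub_cancel_left, ← sub_eq_add_neg] at hR hS
  norm_num [Nat.factorial, iteratedDeriv_one, ← iteratedDeriv_succ'] at hR hS
  generalize hRdef : u (tn + h) - (_ + _) = R at hR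
  generalize hSdef : deriv u (tn - h) - _ = S at hS
  rw [sub_eq_iff_eq_add] at hRdef hSdef
  rw [hRdef, hSdef]
  have hne : h ≠ 0 := hpos.ne'
  constructor
  · calc _ = ‖(6 / (5 * h ^ 2)) • R - (2 / (5 * h)) • S‖ := by
          congr 1
          match_scalars <;> field_simp <;> ring
      _ ≤ 6 / (5 * h ^ 2) * ‖R‖ + 2 / (5 * h) * ‖S‖ := by
          refine (norm_sub_le _ _).trans_eq ?_
          rw [norm_smul, norm_smul, Real.norm_of_nonneg (by positivity),
            Real.norm_of_nonneg (by positivity)]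
      _ ≤ 6 / (5 * h ^ 2) * (A * h ^ 4) + 2 / (5 * h) * (B * h ^ 3) := by gcongr
      _ = (6 / 5 * A + 2 / 5 * B) * h ^ 2 := by field_simp
      _ ≤ (12 / 5 * A + 6 / 5 * B) * h ^ 2 := by gcongr <;> norm_num
  · calc _ = ‖(12 / (5 * h ^ 3)) • R + (6 / (5 * h ^ 2)) • S‖ := by
          congr 1
          match_scalars <;> field_simp <;> ring
      _ ≤ 12 / (5 * h ^ 3) * ‖R‖ + 6 / (5 * h ^ 2) * ‖S‖ := by
          refine (norm_add_le _ _).trans_eq ?_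
          rw [norm_smul, norm_smul, Real.norm_of_nonneg (by positivity),
            Real.norm_of_nonneg (by positivity)]
      _ ≤ 12 / (5 * h ^ 3) * (A * h ^ 4) + 6 / (5 * h ^ 2) * (B * h ^ 3) := by gcongr
      _ = (12 / 5 * A + 6 / 5 * B) * h := by field_simp
end

section
/- Let E be a real Banach space, u : ℝ → E five times continuously differentiable, and tₙ ∈ ℝ. For h > 0 let f₁ = (u(tₙ+h) − u(tₙ) − h·u′(tₙ))/h², f₂ = (u′(tₙ) − u′(tₙ−h))/h, f₃ = (u′(tₙ−h) − u′(tₙ−2h))/h, and define β₁ = (8/9)f₁ + (37/54)f₂ − (7/54)f₃, β₂ = (8/(3h))f₁ − (13/(9h))f₂ + (1/(9h))f₃, β₃ = (8/(3h²))f₁ − (22/(9h²))f₂ + (10/(9h²))f₃, and the interpolating polynomial I(t) = u(tₙ) + (t−tₙ)u′(tₙ) + ((t−tₙ)²/2)β₁ + ((t−tₙ)³/6)β₂ + ((t−tₙ)⁴/24)β₃. Then there exist constants C > 0 and h₀ > 0 such that for all 0 < h ≤ h₀ and all t ∈ [tₙ, tₙ+h], ‖I(t) − u(t)‖ ≤ C·h⁵.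 -/
/-- Two-sided **Taylor theorem** for vector-valued functions: the remainder is bounded by a multiple
of `|x - a| ^ (n + 1)` on every closed interval centred at `a`. -/
theorem ContDiff.exists_norm_sub_taylorWithinEval_univ_le {E : Type*} [NormedAddCommGroup E]
    [NormedSpace ℝ E] {n : ℕ} {f : ℝ → E} (hf : ContDiff ℝ (n + 1) f) (a R : ℝ) :
    ∃ C, 0 ≤ C ∧ ∀ x, |x - a| ≤ R →
      ‖f x - taylorWithinEval f n Set.univ a x‖ ≤ C * |x - a| ^ (n + 1) := by
  induction n generalizing f with
  | zero =>
    have hc : Continuous (deriv f) := hf.continuous_deriv (by simp)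
    obtain ⟨C, hC⟩ := (isCompact_closedBall a R).exists_bound_of_continuousOn hc.continuousOn
    refine ⟨|C|, abs_nonneg C, fun x hx => ?_⟩
    have hR : 0 ≤ R := (abs_nonneg _).trans hx
    have key := (convex_closedBall a R).norm_image_sub_le_of_norm_deriv_le
      (fun y _ => hf.differentiable (by simp) y)
      (fun y hy => (hC y hy).trans (le_abs_self C))
      (Metric.mem_closedBall_self hR) (Metric.mem_closedBall.2 hx)
    simpa using key
  | succ n ih =>
    have hf' : ContDiff ℝ (n + 1) (deriv f) := ContDiff.deriv' (by exact_mod_cast hf)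
    obtain ⟨C, hC0, hC⟩ := ih hf'
    refine ⟨C, hC0, fun x hx => ?_⟩
    have hd : ∀ y, HasDerivAt (fun z => f z - taylorWithinEval f (n + 1) Set.univ a z)
        (deriv f y - taylorWithinEval (deriv f) n Set.univ a y) y := fun y => by
      have hT := hasDerivAt_taylorWithinEval_succ (x₀ := a) (x := y) (s := Set.univ) f n
      rw [derivWithin_univ] at hT
      exact (hf.differentiable (by simp) y).hasDerivAt.sub hT
    have key := (convex_closedBall a |x - a|).norm_image_sub_le_of_norm_hasDerivWithin_le
      (C := C * |x - a| ^ (n + 1))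
      (fun y _ => (hd y).hasDerivWithinAt)
      (fun y hy => by
        have hy' : |y - a| ≤ |x - a| := hy
        exact (hC y (hy'.trans hx)).trans (by gcongr))
      (Metric.mem_closedBall_self (abs_nonneg _)) (Metric.mem_closedBall.2 le_rfl)
    simpa [pow_succ, mul_assoc] using key

/-- A cubic expansion of the derivative of a function of class `C⁵`, and a quartic expansion of the
function itself, with the same coefficients. -/
theorem ContDiff.exists_taylor_four_and_deriv {E : Type*} [NormedAddCommGroup E]
    [NormedSpace ℝ E] {u : ℝ → E} (hu : ContDiff ℝ 5 u) (a R : ℝ) :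
    ∃ v w z : E, ∃ C, 0 ≤ C ∧
      (∀ s, |s| ≤ R → ‖u (a + s) - (u a + s • deriv u a + (s ^ 2 / 2) • v + (s ^ 3 / 6) • w +
        (s ^ 4 / 24) • z)‖ ≤ C * |s| ^ 5) ∧
      ∀ s, |s| ≤ R → ‖deriv u (a + s) - (deriv u a + s • v + (s ^ 2 / 2) • w +
        (s ^ 3 / 6) • z)‖ ≤ C * |s| ^ 4 := by
  have hu' : ContDiff ℝ 4 (deriv u) := ContDiff.deriv' (by exact_mod_cast hu)
  obtain ⟨C₁, hC₁, h₁⟩ :=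
    ContDiff.exists_norm_sub_taylorWithinEval_univ_le (n := 4) (by exact_mod_cast hu) a R
  obtain ⟨C₂, hC₂, h₂⟩ :=
    ContDiff.exists_norm_sub_taylorWithinEval_univ_le (n := 3) (by exact_mod_cast hu') a R
  refine ⟨iteratedDeriv 2 u a, iteratedDeriv 3 u a, iteratedDeriv 4 u a, max C₁ C₂,
    le_max_of_le_left hC₁, fun s hs => ?_, fun s hs => ?_⟩
  · have h := h₁ (a + s) (by simpa using hs)
    simp only [taylor_within_apply, iteratedDerivWithin_univ, add_sub_cancel_left,
      Finset.sum_range_succ, Finset.sum_range_zero, iteratedDeriv_zero, iteratedDeriv_one] at h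
    refine le_trans (le_of_eq ?_) (h.trans (by gcongr; exact le_max_left _ _))
    congr 1
    norm_num [Nat.factorial]
    module
  · have h := h₂ (a + s) (by simpa using hs)
    simp only [taylor_within_apply, iteratedDerivWithin_univ, add_sub_cancel_left,
      Finset.sum_range_succ, Finset.sum_range_zero, ← iteratedDeriv_succ', zero_add,
      iteratedDeriv_one, Nat.reduceAdd] at h
    refine le_trans (le_of_eq ?_) (h.trans (by gcongr; exact le_max_right _ _))
    congr 1
    norm_num [Nat.factorial]
    module

/-- Fourth-order accuracy of the MTS interpolating polynomial:
with `β = (A⁴)⁻¹·f⁴`, the polynomial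
`I(t) = u(tₙ) + (t−tₙ)u′(tₙ) + ((t−tₙ)²/2)β₁ + ((t−tₙ)³/6)β₂ + ((t−tₙ)⁴/24)β₃`
satisfies `‖I(t) − u(t)‖ ≤ C·h⁵` uniformly for `t ∈ [tₙ, tₙ+h]`. -/
theorem mts4_interpolation_error {E : Type*} [NormedAddCommGroup E] [NormedSpace ℝ E]
    [CompleteSpace E] (u : ℝ → E) (hu : ContDiff ℝ 5 u) (tn : ℝ) :
    ∃ C > (0 : ℝ), ∃ h₀ > (0 : ℝ), ∀ h : ℝ, 0 < h → h ≤ h₀ →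
      ∀ t : ℝ, tn ≤ t → t ≤ tn + h →
      ‖u tn + (t - tn) • deriv u tn +
          ((t - tn) ^ 2 / 2) •
            (((8 : ℝ) / 9) • ((h ^ 2)⁻¹ • (u (tn + h) - u tn - h • deriv u tn)) +
              ((37 : ℝ) / 54) • (h⁻¹ • (deriv u tn - deriv u (tn - h))) -
              ((7 : ℝ) / 54) • (h⁻¹ • (deriv u (tn - h) - deriv u (tn - 2 * h)))) +
          ((t - tn) ^ 3 / 6) •
            ((8 / (3 * h)) • ((h ^ 2)⁻¹ • (u (tn + h) - u tn - h • deriv u tn)) -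
              (13 / (9 * h)) • (h⁻¹ • (deriv u tn - deriv u (tn - h))) +
              (1 / (9 * h)) • (h⁻¹ • (deriv u (tn - h) - deriv u (tn - 2 * h)))) +
          ((t - tn) ^ 4 / 24) •
            ((8 / (3 * h ^ 2)) • ((h ^ 2)⁻¹ • (u (tn + h) - u tn - h • deriv u tn)) -
              (22 / (9 * h ^ 2)) • (h⁻¹ • (deriv u tn - deriv u (tn - h))) +
              (10 / (9 * h ^ 2)) • (h⁻¹ • (deriv u (tn - h) - deriv u (tn - 2 * h)))) -
          u t‖ ≤ C * h ^ 5 := by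
  obtain ⟨v, w, z, C, hC, hU, hD⟩ := hu.exists_taylor_four_and_deriv tn 2
  refine ⟨19 * C + 1, by positivity, 1, one_pos, fun h hh hh1 t ht0 ht1 => ?_⟩
  obtain ⟨θ, hθ⟩ : ∃ θ, t = tn + θ * h := ⟨(t - tn) / h, by field_simp; ring⟩
  subst hθ
  have hθ0 : 0 ≤ θ := by
    by_contra! hneg
    nlinarith
  have hθ1 : θ ≤ 1 := by
    by_contra! hgt
    nlinarith
  have hθh : 0 ≤ θ * h := by positivity
  have e₀ := hU (θ * h) (by rw [abs_of_nonneg hθh]; nlinarith)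
  have e₁ := hU h (by rw [abs_of_pos hh]; linarith)
  have e₂ := hD (-h) (by rw [abs_neg, abs_of_pos hh]; linarith)
  have e₃ := hD (-(2 * h)) (by rw [abs_neg, abs_of_pos (by linarith)]; linarith)
  rw [abs_of_nonneg hθh] at e₀
  rw [abs_of_pos hh] at e₁
  rw [abs_neg, abs_of_pos hh, ← sub_eq_add_neg] at e₂
  rw [abs_neg, abs_of_pos (by linarith), ← sub_eq_add_neg] at e₃
  rw [add_sub_cancel_left]
  generalize u (tn + θ * h) = U₀ at *
  generalize u (tn + h) = U₁ at *
  generalize deriv u (tn - h) = D₂ at *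
  generalize deriv u (tn - 2 * h) = D₃ at *
  generalize u tn = U at *
  generalize deriv u tn = D at *
  obtain ⟨r₀, hr₀⟩ : ∃ r, r = U₀ - (U + (θ * h) • D + ((θ * h) ^ 2 / 2) • v +
      ((θ * h) ^ 3 / 6) • w + ((θ * h) ^ 4 / 24) • z) := ⟨_, rfl⟩
  obtain ⟨r₁, hr₁⟩ : ∃ r, r = U₁ - (U + h • D + (h ^ 2 / 2) • v +
      (h ^ 3 / 6) • w + (h ^ 4 / 24) • z) := ⟨_, rfl⟩
  obtain ⟨r₂, hr₂⟩ : ∃ r, r = D₂ - (D + (-h) • v + ((-h) ^ 2 / 2) • w +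
      ((-h) ^ 3 / 6) • z) := ⟨_, rfl⟩
  obtain ⟨r₃, hr₃⟩ : ∃ r, r = D₃ - (D + (-(2 * h)) • v + ((-(2 * h)) ^ 2 / 2) • w +
      ((-(2 * h)) ^ 3 / 6) • z) := ⟨_, rfl⟩
  rw [← hr₀] at e₀
  rw [← hr₁] at e₁
  rw [← hr₂] at e₂
  rw [← hr₃] at e₃
  obtain rfl := sub_eq_iff_eq_add.1 hr₀.symm
  obtain rfl := sub_eq_iff_eq_add.1 hr₁.symm
  obtain rfl := sub_eq_iff_eq_add.1 hr₂.symm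
  obtain rfl := sub_eq_iff_eq_add.1 hr₃.symm
  have hθ2 : θ ^ 2 ≤ 1 := pow_le_one₀ hθ0 hθ1
  have hθ3 : θ ^ 3 ≤ 1 := pow_le_one₀ hθ0 hθ1
  have hθ4 : θ ^ 4 ≤ 1 := pow_le_one₀ hθ0 hθ1
  have p2 : 0 ≤ θ ^ 2 := by positivity
  have p3 : 0 ≤ θ ^ 3 := by positivity
  have p4 : 0 ≤ θ ^ 4 := by positivity
  have c₁ : |4 / 9 * θ ^ 2 + 4 / 9 * θ ^ 3 + 1 / 9 * θ ^ 4| ≤ 1 := by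
    rw [abs_le]; constructor <;> linarith
  have c₂ : |-(11 / 27) * θ ^ 2 + 7 / 27 * θ ^ 3 + 4 / 27 * θ ^ 4| ≤ 1 := by
    rw [abs_le]; constructor <;> linarith
  have c₃ : |7 / 108 * θ ^ 2 - 1 / 54 * θ ^ 3 - 5 / 108 * θ ^ 4| ≤ 1 := by
    rw [abs_le]; constructor <;> linarith
  have e₀' : ‖r₀‖ ≤ C * h ^ 5 := e₀.trans (by gcongr; nlinarith)
  calc _ = ‖(4 / 9 * θ ^ 2 + 4 / 9 * θ ^ 3 + 1 / 9 * θ ^ 4) • r₁ +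
        (-(11 / 27) * θ ^ 2 + 7 / 27 * θ ^ 3 + 4 / 27 * θ ^ 4) • h • r₂ +
        (7 / 108 * θ ^ 2 - 1 / 54 * θ ^ 3 - 5 / 108 * θ ^ 4) • h • r₃ - r₀‖ := by
        congr 1
        match_scalars <;> field_simp <;> ring
    _ ≤ 1 * ‖r₁‖ + 1 * (h * ‖r₂‖) + 1 * (h * ‖r₃‖) + ‖r₀‖ := by
        refine (norm_sub_le _ _).trans ?_
        gcongr
        refine norm_add₃_le.trans ?_
        simp only [norm_smul, Real.norm_eq_abs, abs_of_pos hh]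
        gcongr
    _ ≤ 1 * (C * h ^ 5) + 1 * (h * (C * h ^ 4)) + 1 * (h * (C * (2 * h) ^ 4)) + C * h ^ 5 := by
        gcongr
    _ = 19 * C * h ^ 5 := by ring
    _ ≤ (19 * C + 1) * h ^ 5 := by gcongr; linarith
end

section
/- Let E be a real Banach space, u : ℝ → E four times continuously differentiable, and tₙ ∈ ℝ. For h > 0 let f₁ = (u(tₙ+h) − u(tₙ) − h·u′(tₙ))/h² and f₂ = (u′(tₙ) − u′(tₙ−h))/h, define β₁ = (6/5)f₁ + (2/5)f₂ and β₂ = (12/(5h))f₁ − (6/(5h))f₂, and the interpolating polynomial I(t) = u(tₙ) + (t−tₙ)u′(tₙ) + ((t−tₙ)²/2)β₁ + ((t−tₙ)³/6)β₂. Then there exist constants C > 0 and h₀ > 0 such that for all 0 < h ≤ h₀ and all t ∈ [tₙ, tₙ+h], ‖I(t) − u(t)‖ ≤ C·h⁴. -/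
open Topology in
theorem taylorWithinEval_univ_isBigO {E : Type*} [NormedAddCommGroup E] [NormedSpace ℝ E]
    {f : ℝ → E} (x₀ : ℝ) (n : ℕ) (hf : ContDiff ℝ (n + 1 : ℕ) f) :
    (fun x ↦ f x - taylorWithinEval f n Set.univ x₀ x) =O[𝓝 x₀] fun x ↦ (x - x₀) ^ (n + 1) := by
  have h1 := (taylor_isLittleO_univ (x₀ := x₀) hf).isBigO
  have h2 : (fun x ↦ (((n + 1 : ℝ) * n.factorial)⁻¹ * (x - x₀) ^ (n + 1)) •
      iteratedDerivWithin (n + 1) f Set.univ x₀) =O[𝓝 x₀] fun x ↦ (x - x₀) ^ (n + 1) := by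
    refine Asymptotics.IsBigO.of_bound
      (‖((n + 1 : ℝ) * n.factorial)⁻¹‖ * ‖iteratedDerivWithin (n + 1) f Set.univ x₀‖)
      (.of_forall fun x ↦ ?_)
    rw [norm_smul, norm_mul]
    exact le_of_eq (by ring)
  refine (h1.add h2).congr_left fun x ↦ ?_
  rw [taylorWithinEval_succ]
  abel

/-- Local Taylor estimates at `a` for a `C⁴` function and for its derivative. -/
theorem exists_local_taylor_bounds {E : Type*} [NormedAddCommGroup E] [NormedSpace ℝ E]
    {u : ℝ → E} (hu : ContDiff ℝ 4 u) (a : ℝ) :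
    ∃ K ≥ (0 : ℝ), ∃ δ > (0 : ℝ), ∃ v w : E, ∀ s : ℝ, |s| ≤ δ →
      ‖u (a + s) - (u a + s • deriv u a + (s ^ 2 / 2) • v + (s ^ 3 / 6) • w)‖ ≤ K * |s| ^ 4 ∧
      ‖deriv u (a + s) - (deriv u a + s • v + (s ^ 2 / 2) • w)‖ ≤ K * |s| ^ 3 := by
  have hu' : ContDiff ℝ (2 + 1 : ℕ) (deriv u) :=
    (contDiff_succ_iff_deriv (n := (3 : ℕ)).1 (by exact_mod_cast hu)).2.2
  obtain ⟨A, hA⟩ := (taylorWithinEval_univ_isBigO a 3 (f := u) (by exact_mod_cast hu)).bound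
  obtain ⟨B, hB⟩ := (taylorWithinEval_univ_isBigO a 2 hu').bound
  obtain ⟨δ, hδ, hball⟩ := Metric.eventually_nhds_iff.1 (hA.and hB)
  refine ⟨max 0 (max A B), le_max_left _ _, δ / 2, by positivity, deriv (deriv u) a,
    deriv (deriv (deriv u)) a, fun s hs ↦ ?_⟩
  obtain ⟨h1, h2⟩ := @hball (a + s) (by rw [Real.dist_eq, add_sub_cancel_left]; linarith)
  simp only [taylorWithinEval_succ, taylor_within_zero_eval, iteratedDerivWithin_univ,
    iteratedDeriv_succ, iteratedDeriv_zero, add_sub_cancel_left, norm_pow, Real.norm_eq_abs]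
    at h1 h2
  have hAK : A ≤ max 0 (max A B) := (le_max_left A B).trans (le_max_right _ _)
  have hBK : B ≤ max 0 (max A B) := (le_max_right A B).trans (le_max_right _ _)
  constructor
  · refine le_trans (le_of_eq ?_) (h1.trans (by gcongr))
    congr 2
    norm_num [Nat.factorial]
    module
  · refine le_trans (le_of_eq ?_) (h2.trans (by gcongr))
    congr 2
    norm_num [Nat.factorial]
    module


/-- Third-order accuracy of the MTS interpolating polynomial:
with `β = (A³)⁻¹·f³`, the polynomial
`I(t) = u(tₙ) + (t−tₙ)u′(tₙ) + ((t−tₙ)²/2)β₁ + ((t−tₙ)³/6)β₂`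
satisfies `‖I(t) − u(t)‖ ≤ C·h⁴` uniformly for `t ∈ [tₙ, tₙ+h]`. -/
theorem mts3_interpolation_error {E : Type*} [NormedAddCommGroup E] [NormedSpace ℝ E]
    [CompleteSpace E] (u : ℝ → E) (hu : ContDiff ℝ 4 u) (tn : ℝ) :
    ∃ C > (0 : ℝ), ∃ h₀ > (0 : ℝ), ∀ h : ℝ, 0 < h → h ≤ h₀ →
      ∀ t : ℝ, tn ≤ t → t ≤ tn + h →
      ‖u tn + (t - tn) • deriv u tn +
          ((t - tn) ^ 2 / 2) •
            (((6 : ℝ) / 5) • ((h ^ 2)⁻¹ • (u (tn + h) - u tn - h • deriv u tn)) +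
              ((2 : ℝ) / 5) • (h⁻¹ • (deriv u tn - deriv u (tn - h)))) +
          ((t - tn) ^ 3 / 6) •
            ((12 / (5 * h)) • ((h ^ 2)⁻¹ • (u (tn + h) - u tn - h • deriv u tn)) -
              (6 / (5 * h)) • (h⁻¹ • (deriv u tn - deriv u (tn - h)))) -
          u t‖ ≤ C * h ^ 4 := by
  obtain ⟨K, hK, δ, hδ, v, w, hT⟩ := exists_local_taylor_bounds hu tn
  refine ⟨4 * K + 1, by positivity, δ, hδ, fun h hh hhδ t ht1 ht2 ↦ ?_⟩
  obtain ⟨s, rfl⟩ : ∃ s, t = tn + s := ⟨t - tn, by ring⟩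
  have hs0 : 0 ≤ s := by linarith
  have hsh : s ≤ h := by linarith
  have hRs := (hT s (by rw [abs_of_nonneg hs0]; linarith)).1
  have hRh := (hT h (by rwa [abs_of_pos hh])).1
  have hRd := (hT (-h) (by rwa [abs_neg, abs_of_pos hh])).2
  rw [abs_of_nonneg hs0] at hRs
  rw [abs_of_pos hh] at hRh
  rw [abs_neg, abs_of_pos hh, ← sub_eq_add_neg] at hRd
  set Rs := u (tn + s) - (u tn + s • deriv u tn + (s ^ 2 / 2) • v + (s ^ 3 / 6) • w) with hRs_def
  set Rh := u (tn + h) - (u tn + h • deriv u tn + (h ^ 2 / 2) • v + (h ^ 3 / 6) • w) with hRh_def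
  set Rd := deriv u (tn - h) - (deriv u tn + (-h) • v + ((-h) ^ 2 / 2) • w) with hRd_def
  have hus : u (tn + s) = u tn + s • deriv u tn + (s ^ 2 / 2) • v + (s ^ 3 / 6) • w + Rs := by
    rw [hRs_def]; abel
  have huh : u (tn + h) = u tn + h • deriv u tn + (h ^ 2 / 2) • v + (h ^ 3 / 6) • w + Rh := by
    rw [hRh_def]; abel
  have hud : deriv u (tn - h) = deriv u tn + (-h) • v + ((-h) ^ 2 / 2) • w + Rd := by
    rw [hRd_def]; abel
  clear_value Rs Rh Rd
  have hne : h ≠ 0 := hh.ne'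
  obtain ⟨r, rfl⟩ : ∃ r, s = r * h := ⟨s / h, by field_simp⟩
  have hr0 : 0 ≤ r := nonneg_of_mul_nonneg_left hs0 hh
  have hr1 : r ≤ 1 := by nlinarith
  have key : u tn + (tn + r * h - tn) • deriv u tn +
          ((tn + r * h - tn) ^ 2 / 2) •
            (((6 : ℝ) / 5) • ((h ^ 2)⁻¹ • (u (tn + h) - u tn - h • deriv u tn)) +
              ((2 : ℝ) / 5) • (h⁻¹ • (deriv u tn - deriv u (tn - h)))) +
          ((tn + r * h - tn) ^ 3 / 6) •
            ((12 / (5 * h)) • ((h ^ 2)⁻¹ • (u (tn + h) - u tn - h • deriv u tn)) -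
              (6 / (5 * h)) • (h⁻¹ • (deriv u tn - deriv u (tn - h)))) -
          u (tn + r * h) =
      (3 / 5 * r ^ 2 + 2 / 5 * r ^ 3) • Rh + ((r ^ 3 - r ^ 2) / 5 * h) • Rd - Rs := by
    rw [hus, huh, hud]
    match_scalars <;> field_simp <;> ring
  rw [key]
  have hr2 : r ^ 2 ≤ 1 := pow_le_one₀ hr0 hr1
  have hr3 : r ^ 3 ≤ 1 := pow_le_one₀ hr0 hr1
  have hr2' : 0 ≤ r ^ 2 := by positivity
  have hr3' : 0 ≤ r ^ 3 := by positivity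
  have b1 : ‖(3 / 5 * r ^ 2 + 2 / 5 * r ^ 3) • Rh‖ ≤ 1 * (K * h ^ 4) := by
    rw [norm_smul, Real.norm_of_nonneg (by positivity)]
    gcongr
    linarith
  have b2 : ‖((r ^ 3 - r ^ 2) / 5 * h) • Rd‖ ≤ (1 * h) * (K * h ^ 3) := by
    rw [norm_smul, norm_mul, Real.norm_of_nonneg hh.le]
    gcongr
    rw [Real.norm_eq_abs, abs_le]
    constructor <;> linarith
  have b3 : ‖Rs‖ ≤ K * h ^ 4 := hRs.trans (by gcongr)
  have hh4 : 0 ≤ h ^ 4 := by positivity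
  have hKh : 0 ≤ K * h ^ 4 := by positivity
  calc _ ≤ ‖(3 / 5 * r ^ 2 + 2 / 5 * r ^ 3) • Rh‖ + ‖((r ^ 3 - r ^ 2) / 5 * h) • Rd‖ + ‖Rs‖ :=
        (norm_sub_le _ _).trans (by gcongr; exact norm_add_le _ _)
    _ ≤ (4 * K + 1) * h ^ 4 := by nlinarith
end

section
/- Let E be a real Banach space and F : ℝ × E → E three times continuously differentiable with all derivatives up to order three bounded. Let u : ℝ → E satisfy u′(t) = F(t, u(t)) for all t, and fix t ∈ ℝ. Define for h > 0 the Runge–Kutta stages k₁ = F(t, u(t)), k₂ = F(t + (2/3)h, u(t) + (2/3)h·k₁), k₃ = F(t + (2/3)h, u(t) + (2/3)h·k₂), and the step Φ(h) = u(t) + h·((1/4)k₁ + (3/8)k₂ + (3/8)k₃). Then there exist constants C > 0 and h₀ > 0 such that for all 0 < h ≤ h₀, ‖u(t+h) − Φ(h)‖ ≤ C·h⁴. -/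
open Asymptotics Filter Topology

/-- If the derivative of `G` is `O(‖v‖ ^ n)` at the origin and `G 0 = 0`, then `G` is
`O(‖v‖ ^ (n + 1))`. -/
theorem isBigO_norm_pow_succ_of_hasFDerivAt {X Y : Type*} [NormedAddCommGroup X]
    [NormedSpace ℝ X] [NormedAddCommGroup Y] [NormedSpace ℝ Y] {G : X → Y} {G' : X → X →L[ℝ] Y}
    {n : ℕ} (hG : ∀ v, HasFDerivAt G (G' v) v) (h0 : G 0 = 0)
    (hG' : G' =O[𝓝 0] fun v => ‖v‖ ^ n) : G =O[𝓝 0] fun v => ‖v‖ ^ (n + 1) := by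
  obtain ⟨C, hCpos, hC⟩ := hG'.exists_pos
  obtain ⟨ε, hε, hball⟩ := Metric.eventually_nhds_iff_ball.1 hC.bound
  refine IsBigO.of_bound C (Metric.eventually_nhds_iff_ball.2 ⟨ε, hε, fun v hv => ?_⟩)
  have hv' : ‖v‖ < ε := by simpa using hv
  have key := (convex_closedBall (0 : X) ‖v‖).norm_image_sub_le_of_norm_hasFDerivWithin_le
    (f := G) (f' := G') (C := C * ‖v‖ ^ n) (fun x _ => (hG x).hasFDerivWithinAt)
    (fun x hx => by
      have hx' : ‖x‖ ≤ ‖v‖ := by simpa using hx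
      have h1 := hball x (by simpa using hx'.trans_lt hv')
      rw [norm_pow, norm_norm] at h1
      exact h1.trans (by gcongr)) (x := 0) (y := v) (by simp) (by simp)
  rw [h0, sub_zero, sub_zero] at key
  rw [norm_pow, norm_norm, pow_succ, ← mul_assoc]
  exact key

/-- One-variable version of `isBigO_norm_pow_succ_of_hasFDerivAt`. -/
theorem isBigO_pow_succ_of_hasDerivAt {Y : Type*} [NormedAddCommGroup Y] [NormedSpace ℝ Y]
    {g g' : ℝ → Y} {n : ℕ} (hg : ∀ h, HasDerivAt g (g' h) h) (h0 : g 0 = 0)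
    (hg' : g' =O[𝓝 0] fun h => h ^ n) : g =O[𝓝 0] fun h => h ^ (n + 1) := by
  have key := isBigO_norm_pow_succ_of_hasFDerivAt (n := n) (fun h => (hg h).hasFDerivAt) h0 <| by
    exact (IsBigO.norm_norm hg').congr (fun h => by simp) (fun h => by simp) |>.of_norm_left
  simpa only [← norm_pow, isBigO_norm_right] using key

theorem isBigO_pow_pow_nhds_zero {m n : ℕ} (hmn : m ≤ n) :
    (fun h : ℝ => h ^ n) =O[𝓝 0] fun h : ℝ => h ^ m := by
  obtain ⟨k, rfl⟩ := Nat.exists_eq_add_of_le hmn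
  have hk : (fun h : ℝ => h ^ k) =O[𝓝 0] fun _ => (1 : ℝ) :=
    ((continuous_pow k).tendsto 0).isBigO_one ℝ
  simpa [pow_add] using (isBigO_refl (fun h : ℝ => h ^ m) (𝓝 0)).mul hk

theorem isBigO_pow_smul_const {Z : Type*} [NormedAddCommGroup Z] [NormedSpace ℝ Z] (n : ℕ)
    (z : Z) : (fun h : ℝ => h ^ n • z) =O[𝓝 0] fun h : ℝ => h ^ n := by
  simpa using (isBigO_refl (fun h : ℝ => h ^ n) (𝓝 0)).smul
    (isBigO_const_const z (one_ne_zero (α := ℝ)) (𝓝 0))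

theorem Asymptotics.IsBigO.clm_apply₂_pow {X Y : Type*} [NormedAddCommGroup X]
    [NormedSpace ℝ X] [NormedAddCommGroup Y] [NormedSpace ℝ Y] (B : X →L[ℝ] X →L[ℝ] Y)
    {v w : ℝ → X} {m n : ℕ} (hv : v =O[𝓝 0] fun h : ℝ => h ^ m)
    (hw : w =O[𝓝 0] fun h : ℝ => h ^ n) :
    (fun h => B (v h) (w h)) =O[𝓝 0] fun h : ℝ => h ^ (m + n) := by
  refine (B.isBoundedBilinearMap.isBigO_comp (g := v) (h := w)).trans ?_
  simpa only [pow_add] using hv.norm_left.mul hw.norm_left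

/-- Second-order Taylor expansion of a `C^3` map between normed spaces. -/
theorem ContDiff.isBigO_taylor_two {X Y : Type*} [NormedAddCommGroup X]
    [NormedSpace ℝ X] [NormedAddCommGroup Y] [NormedSpace ℝ Y] {F : X → Y}
    (hF : ContDiff ℝ 3 F) (x : X) :
    (fun v => F (x + v) - F x - fderiv ℝ F x v
      - (1 / 2 : ℝ) • fderiv ℝ (fderiv ℝ F) x v v) =O[𝓝 0] fun v => ‖v‖ ^ 3 := by
  have hF1 : ContDiff ℝ 2 (fderiv ℝ F) := hF.fderiv_right (by norm_num)
  have hF2 : ContDiff ℝ 1 (fderiv ℝ (fderiv ℝ F)) := hF1.fderiv_right (by norm_num)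
  have hsymm : IsSymmSndFDerivAt ℝ F x :=
    hF.contDiffAt.isSymmSndFDerivAt (by simp; norm_num)
  have hsh : ∀ v : X, HasFDerivAt (fun v : X => x + v) (ContinuousLinearMap.id ℝ X) v :=
    fun v => (hasFDerivAt_id v).const_add x
  have h2 : (fun v => fderiv ℝ (fderiv ℝ F) (x + v) - fderiv ℝ (fderiv ℝ F) x)
      =O[𝓝 0] fun v : X => ‖v‖ ^ 1 := by
    have := ((hF2.differentiable (by norm_num)).differentiableAt (x := x)).isBigO_sub
    have hten : Tendsto (fun v : X => x + v) (𝓝 0) (𝓝 x) :=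
      (by fun_prop : Continuous fun v : X => x + v).tendsto' 0 x (add_zero x)
    simpa [Function.comp_def] using (this.comp_tendsto hten).norm_right
  have h1 := isBigO_norm_pow_succ_of_hasFDerivAt
    (G := fun v => fderiv ℝ F (x + v) - fderiv ℝ F x - fderiv ℝ (fderiv ℝ F) x v)
    (fun v => by
      have := ((hF1.differentiable (by norm_num)).differentiableAt (x := x + v)).hasFDerivAt
      exact ((this.comp v (hsh v)).sub_const (fderiv ℝ F x)).sub
        (fderiv ℝ (fderiv ℝ F) x).hasFDerivAt) (by simp) h2
  refine isBigO_norm_pow_succ_of_hasFDerivAt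
    (fun v => ?_) (by simp) h1
  have hd := ((hF.differentiable (by norm_num)).differentiableAt (x := x + v)).hasFDerivAt
  have hq := ((fderiv ℝ (fderiv ℝ F) x).hasFDerivAt (x := v)).clm_apply (hasFDerivAt_id v)
  refine ((((hd.comp v (hsh v)).sub_const (F x)).sub
    (fderiv ℝ F x).hasFDerivAt).sub (hq.const_smul (1 / 2 : ℝ))).congr_fderiv ?_
  ext w
  have := hsymm v w
  simp [this]
  module

/-- First-order expansion of a `C^3` map along a curve. -/
theorem ContDiff.isBigO_comp_curve_one {X Y : Type*} [NormedAddCommGroup X]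
    [NormedSpace ℝ X] [NormedAddCommGroup Y] [NormedSpace ℝ Y] {F : X → Y}
    (hF : ContDiff ℝ 3 F) (x a : X) {v : ℝ → X}
    (hv : (fun h => v h - h • a) =O[𝓝 0] fun h : ℝ => h ^ 2) :
    (fun h => F (x + v h) - F x - h • fderiv ℝ F x a) =O[𝓝 0] fun h : ℝ => h ^ 2 := by
  have hv1 : v =O[𝓝 0] fun h : ℝ => h ^ 1 :=
    ((hv.trans (isBigO_pow_pow_nhds_zero (by norm_num))).add
      (isBigO_pow_smul_const 1 a)).congr_left fun h => by module
  have hten : Tendsto v (𝓝 0) (𝓝 0) :=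
    hv1.trans_tendsto ((continuous_pow 1).tendsto' 0 0 (by simp))
  have hT := ((hF.isBigO_taylor_two x).comp_tendsto hten).trans (hv1.norm_left.pow 3)
  have hT' := (hT.congr_right (g₂ := fun h : ℝ => h ^ 3) fun h => by simp).trans
    (isBigO_pow_pow_nhds_zero (m := 2) (by norm_num))
  have hA := ((fderiv ℝ F x).isBigO_comp (fun h => v h - h • a) (𝓝 0)).trans hv
  have hB := (IsBigO.clm_apply₂_pow (fderiv ℝ (fderiv ℝ F) x) hv1 hv1).const_smul_left (1 / 2 : ℝ)
  refine (hT'.add (hA.add hB)).congr_left fun h => ?_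
  simp only [Function.comp_apply, Pi.smul_apply, map_sub, map_smul]
  module

/-- Second-order expansion of a `C^3` map along a curve. -/
theorem ContDiff.isBigO_comp_curve_two {X Y : Type*} [NormedAddCommGroup X]
    [NormedSpace ℝ X] [NormedAddCommGroup Y] [NormedSpace ℝ Y] {F : X → Y}
    (hF : ContDiff ℝ 3 F) (x a b : X) {v : ℝ → X}
    (hv : (fun h => v h - h • a - h ^ 2 • b) =O[𝓝 0] fun h : ℝ => h ^ 3) :
    (fun h => F (x + v h) - F x - h • fderiv ℝ F x a
      - h ^ 2 • (fderiv ℝ F x b + (1 / 2 : ℝ) • fderiv ℝ (fderiv ℝ F) x a a))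
      =O[𝓝 0] fun h : ℝ => h ^ 3 := by
  set A := fderiv ℝ F x
  set B := fderiv ℝ (fderiv ℝ F) x
  have hv2 : (fun h => v h - h • a) =O[𝓝 0] fun h : ℝ => h ^ 2 :=
    ((hv.trans (isBigO_pow_pow_nhds_zero (by norm_num))).add
      (isBigO_pow_smul_const 2 b)).congr_left fun h => by module
  have hv1 : v =O[𝓝 0] fun h : ℝ => h ^ 1 :=
    ((hv2.trans (isBigO_pow_pow_nhds_zero (by norm_num))).add
      (isBigO_pow_smul_const 1 a)).congr_left fun h => by module
  have hten : Tendsto v (𝓝 0) (𝓝 0) :=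
    hv1.trans_tendsto ((continuous_pow 1).tendsto' 0 0 (by simp))
  have hT := ((hF.isBigO_taylor_two x).comp_tendsto hten).trans (hv1.norm_left.pow 3)
  have hA := (A.isBigO_comp (fun h => v h - h • a - h ^ 2 • b) (𝓝 0)).trans hv
  have hB1 := IsBigO.clm_apply₂_pow B hv2 hv1
  have hB2 := IsBigO.clm_apply₂_pow B (isBigO_pow_smul_const 1 a) hv2
  refine ((hT.congr_right fun h => by simp).add
    (hA.add ((hB1.add hB2).const_smul_left (1 / 2 : ℝ)))).congr_left fun h => ?_
  simp only [Function.comp_apply, Pi.smul_apply, map_sub, map_smul, sub_apply, smul_apply,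
    A, B, pow_one]
  module

/-- Third-order Taylor expansion of a solution of `u' = F (s, u)`. -/
theorem isBigO_taylor_of_ode_solution {E : Type*} [NormedAddCommGroup E] [NormedSpace ℝ E]
    {F : ℝ × E → E} (hF : ContDiff ℝ 3 F) {u : ℝ → E}
    (hu : ∀ s : ℝ, HasDerivAt u (F (s, u s)) s) (t : ℝ) {x d : ℝ × E} (hx : x = (t, u t))
    (hd : d = (1, F x)) :
    (fun h => u (t + h) - u t - h • F x - h ^ 2 • (1 / 2 : ℝ) • fderiv ℝ F x d
      - h ^ 3 • (1 / 6 : ℝ) • (fderiv ℝ F x (0, fderiv ℝ F x d)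
        + fderiv ℝ (fderiv ℝ F) x d d)) =O[𝓝 0] fun h : ℝ => h ^ 4 := by
  set A := fderiv ℝ F x
  set B := fderiv ℝ (fderiv ℝ F) x
  have hpair : ∀ {n : ℕ} {r : ℝ → E}, r =O[𝓝 0] (fun h : ℝ => h ^ n) →
      (fun h => ((0 : ℝ), r h)) =O[𝓝 0] fun h : ℝ => h ^ n :=
    fun hr => (isBigO_zero _ _).prod_left hr
  have hxv : ∀ h : ℝ, x + (h, u (t + h) - u t) = (t + h, u (t + h)) := fun h => by simp [hx]
  have hder : ∀ h : ℝ,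
      HasDerivAt (fun h => u (t + h) - u t) (F (x + (h, u (t + h) - u t))) h := fun h => by
    rw [hxv]
    exact ((hu (t + h)).comp_const_add t h).sub_const _
  have hpow : ∀ (n : ℕ) (c : E) (h : ℝ),
      HasDerivAt (fun h : ℝ => h ^ n • c) ((n * h ^ (n - 1)) • c) h :=
    fun n c h => (hasDerivAt_pow n h).smul_const c
  have hlin : ∀ (c : E) (h : ℝ), HasDerivAt (fun h : ℝ => h • c) c h := fun c h => by
    simpa using (hasDerivAt_id h).smul_const c
  have e0 : (fun h => F (x + (h, u (t + h) - u t)) - F x) =O[𝓝 0] fun h : ℝ => h ^ 1 := by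
    have hdiff : DifferentiableAt ℝ (fun h => F (x + (h, u (t + h) - u t))) 0 := by
      have h1 := hF.differentiable (by norm_num)
      have h2 : Differentiable ℝ (fun h => u (t + h) - u t) :=
        fun h => (hder h).differentiableAt
      fun_prop
    simpa [hx] using hdiff.isBigO_sub
  have e1 := isBigO_pow_succ_of_hasDerivAt (g := fun h => u (t + h) - u t - h • F x)
    (fun h => (hder h).sub (hlin (F x) h)) (by simp) e0
  have f1 := hF.isBigO_comp_curve_one x d (v := fun h => (h, u (t + h) - u t))
    ((hpair e1).congr_left fun h => by simp [hd])
  have e2 := isBigO_pow_succ_of_hasDerivAt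
    (g := fun h => u (t + h) - u t - h • F x - h ^ 2 • (1 / 2 : ℝ) • A d)
    (fun h => (((hder h).sub (hlin (F x) h)).sub (hpow 2 _ h))) (by simp)
    (f1.congr_left fun h => by push_cast; module)
  have f2 := hF.isBigO_comp_curve_two x d ((1 / 2 : ℝ) • (0, A d))
    (v := fun h => (h, u (t + h) - u t)) ((hpair e2).congr_left fun h => by simp [hd])
  exact isBigO_pow_succ_of_hasDerivAt
    (fun h => ((((hder h).sub (hlin (F x) h)).sub (hpow 2 _ h)).sub (hpow 3 _ h))) (by simp)
    (f2.congr_left fun h => by rw [map_smul]; push_cast; module)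

/-- Local truncation error of the third-order, three-stage explicit Runge–Kutta method
(RK3) with Butcher tableau `c = (0, 2/3, 2/3)`, `a₂₁ = a₃₂ = 2/3`, `a₃₁ = 0`,
`b = (1/4, 3/8, 3/8)`: one step from the exact solution approximates `u(t+h)` to
fourth order in `h`. -/
theorem rk3_local_truncation_error {E : Type*} [NormedAddCommGroup E] [NormedSpace ℝ E]
    [CompleteSpace E] (F : ℝ × E → E) (hF : ContDiff ℝ 3 F)
    (hFbdd : ∀ i : ℕ, i ≤ 3 → ∃ M : ℝ, ∀ x : ℝ × E, ‖iteratedFDeriv ℝ i F x‖ ≤ M)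
    (u : ℝ → E) (hu : ∀ s : ℝ, HasDerivAt u (F (s, u s)) s) (t : ℝ) :
    ∃ C > (0 : ℝ), ∃ h₀ > (0 : ℝ), ∀ h : ℝ, 0 < h → h ≤ h₀ →
      ‖u (t + h) -
          (u t + h •
            (((1 : ℝ) / 4) • F (t, u t) +
             ((3 : ℝ) / 8) • F (t + (2 / 3) * h, u t + ((2 / 3) * h) • F (t, u t)) +
             ((3 : ℝ) / 8) • F (t + (2 / 3) * h,
               u t + ((2 / 3) * h) •
                 F (t + (2 / 3) * h, u t + ((2 / 3) * h) • F (t, u t)))))‖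
        ≤ C * h ^ 4 := by
  set x : ℝ × E := (t, u t) with hx
  set d : ℝ × E := (1, F x) with hd
  set A := fderiv ℝ F x with hA
  set B := fderiv ℝ (fderiv ℝ F) x with hB
  have eu := isBigO_taylor_of_ode_solution hF hu t hx hd
  have k2 := hF.isBigO_comp_curve_two x ((2 / 3 : ℝ) • d) 0
    (v := fun h : ℝ => h • (2 / 3 : ℝ) • d) ((isBigO_zero _ _).congr_left fun h => by simp)
  have k2' : (fun h : ℝ => F (x + h • (2 / 3 : ℝ) • d) - F x - h • A ((2 / 3 : ℝ) • d))
      =O[𝓝 0] fun h : ℝ => h ^ 2 :=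
    hF.isBigO_comp_curve_one x ((2 / 3 : ℝ) • d)
      ((isBigO_zero _ _).congr_left fun h => by simp)
  have k2'' : (fun h : ℝ => ((2 / 3) * h) •
      (F (x + h • (2 / 3 : ℝ) • d) - F x - h • A ((2 / 3 : ℝ) • d)))
      =O[𝓝 0] fun h : ℝ => h ^ 3 :=
    (((isBigO_refl (fun h : ℝ => h) (𝓝 0)).const_mul_left (2 / 3)).smul k2').congr_right
      fun h => by simp only [smul_eq_mul]; ring
  have k3 := hF.isBigO_comp_curve_two x ((2 / 3 : ℝ) • d) ((4 / 9 : ℝ) • (0, A d))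
    (v := fun h : ℝ => ((2 / 3) * h, ((2 / 3) * h) • F (x + h • (2 / 3 : ℝ) • d)))
    (((isBigO_zero _ _).prod_left k2'').congr_left fun h => by
      ext
      · simp [hd]; ring
      · simp only [hd, map_smul, Prod.snd_sub, Prod.smul_snd]
        module)
  have hmul : ∀ {r : ℝ → E}, r =O[𝓝 0] (fun h : ℝ => h ^ 3) →
      (fun h => h • (3 / 8 : ℝ) • r h) =O[𝓝 0] fun h : ℝ => h ^ 4 := fun hr =>
    ((isBigO_refl (fun h : ℝ => h) (𝓝 0)).smul (hr.const_smul_left (3 / 8 : ℝ))).congr_right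
      fun h => by simp only [smul_eq_mul]; ring
  obtain ⟨C, hC, hbound⟩ := ((eu.sub (hmul k2)).sub (hmul k3)).exists_pos
  obtain ⟨ε, hε, hball⟩ := Metric.eventually_nhds_iff_ball.1 hbound.bound
  refine ⟨C, hC, ε / 2, by positivity, fun h h0 hle => ?_⟩
  have key := hball h (by
    rw [mem_ball_zero_iff, Real.norm_of_nonneg h0.le]
    linarith)
  rw [Real.norm_of_nonneg (by positivity : 0 ≤ h ^ 4)] at key
  have s2 : x + h • (2 / 3 : ℝ) • d = (t + (2 / 3) * h, u t + ((2 / 3) * h) • F x) := by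
    ext
    · simp [hx, hd]; ring
    · simp only [hx, hd, Prod.snd_add, Prod.smul_snd]; module
  refine le_of_eq_of_le (congrArg norm ?_) key
  have s3 : ∀ k : E, x + ((2 / 3) * h, ((2 / 3) * h) • k)
      = (t + (2 / 3) * h, u t + ((2 / 3) * h) • k) := fun k => rfl
  simp only [s2, s3, map_smul, map_zero, smul_apply, ← hA, ← hB]
  module
end

section
/- Let E be a real Banach space and F : ℝ × E → E four times continuously differentiable with all derivatives up to order four bounded. Let u : ℝ → E satisfy u′(t) = F(t, u(t)) for all t, and fix t ∈ ℝ. Define for h > 0 the Runge–Kutta stages k₁ = F(t, u(t)), k₂ = F(t + h/2, u(t) + (h/2)·k₁), k₃ = F(t + h/2, u(t) + (h/2)·k₂), k₄ = F(t + h, u(t) + h·k₃), and the step Φ(h) = u(t) + h·((1/6)k₁ + (1/3)k₂ + (1/3)k₃ + (1/6)k₄). Then there exist constants C > 0 and h₀ > 0 such that for all 0 < h ≤ h₀, ‖u(t+h) − Φ(h)‖ ≤ C·h⁵. -/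
open Filter Asymptotics Topology

/-- If `f 0 = 0` and the derivative of `f` is `O(‖v‖ ^ k)` at `0`, then `f` is
`O(‖v‖ ^ (k + 1))` at `0`. -/
theorem isBigO_norm_pow_succ_of_hasFDerivAt_s13 {V W : Type*} [NormedAddCommGroup V]
    [NormedSpace ℝ V] [NormedAddCommGroup W] [NormedSpace ℝ W] {f : V → W} {f' : V → V →L[ℝ] W}
    {k : ℕ} (h0 : f 0 = 0) (hf : ∀ v, HasFDerivAt f (f' v) v)
    (hf' : f' =O[𝓝 0] fun v => ‖v‖ ^ k) : f =O[𝓝 0] fun v => ‖v‖ ^ (k + 1) := by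
  obtain ⟨C, hC, hb⟩ := hf'.exists_pos
  obtain ⟨r, hr, hball⟩ := Metric.eventually_nhds_iff_ball.1 hb.bound
  refine IsBigO.of_bound C (Metric.eventually_nhds_iff_ball.2 ⟨r, hr, fun v hv => ?_⟩)
  have key := (convex_closedBall (0 : V) ‖v‖).norm_image_sub_le_of_norm_hasFDerivWithin_le
    (C := C * ‖v‖ ^ k) (f := f) (f' := f') (x := 0) (y := v)
    (fun x _ => (hf x).hasFDerivWithinAt) (fun x hx => ?_) (by simp) (by simp)
  · simpa [h0, pow_succ, mul_assoc] using key
  · have hx' : ‖x‖ ≤ ‖v‖ := by simpa using hx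
    have hv' : ‖v‖ < r := by simpa using hv
    have := hball x (by simpa using hx'.trans_lt hv')
    rw [norm_pow, norm_norm] at this
    exact this.trans (by gcongr)

set_option maxSynthPendingDepth 6 in
/-- Third-order Taylor expansion of a `C^4` map, with a symmetric second-order term. -/
theorem ContDiff.exists_taylor_three {V W : Type*} [NormedAddCommGroup V]
    [NormedSpace ℝ V] [NormedAddCommGroup W] [NormedSpace ℝ W] {f : V → W}
    (hf : ContDiff ℝ 4 f) (z : V) :
    ∃ (A : V →L[ℝ] W) (B : V →L[ℝ] V →L[ℝ] W) (T : V →L[ℝ] V →L[ℝ] V →L[ℝ] W),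
      (∀ v w, B v w = B w v) ∧
      (fun v => f (z + v) - (f z + A v + (1 / 2 : ℝ) • B v v + (1 / 6 : ℝ) • T v v v))
        =O[𝓝 0] fun v => ‖v‖ ^ 4 := by
  have hD1 : ContDiff ℝ 3 (fderiv ℝ f) := hf.fderiv_right (by norm_num)
  have hD2 : ContDiff ℝ 2 (fderiv ℝ (fderiv ℝ f)) := hD1.fderiv_right (by norm_num)
  have hD3 : ContDiff ℝ 1 (fderiv ℝ (fderiv ℝ (fderiv ℝ f))) := hD2.fderiv_right (by norm_num)
  have symm2 : ∀ x v w, fderiv ℝ (fderiv ℝ f) x v w = fderiv ℝ (fderiv ℝ f) x w v :=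
    fun x v w => (hf.contDiffAt.isSymmSndFDerivAt (by simp; norm_num)).eq v w
  have symm3 : ∀ v w, fderiv ℝ (fderiv ℝ (fderiv ℝ f)) z v w =
      fderiv ℝ (fderiv ℝ (fderiv ℝ f)) z w v :=
    fun v w => (hD1.contDiffAt.isSymmSndFDerivAt (by simp; norm_num)).eq v w
  have d1 : ∀ v, HasFDerivAt (fun v => f (z + v)) (fderiv ℝ f (z + v)) v := fun v =>
    (hasFDerivAt_comp_add_left z).2 ((hf.differentiable (by norm_num)) (z + v)).hasFDerivAt
  have d2 : ∀ v, HasFDerivAt (fun v => fderiv ℝ f (z + v)) (fderiv ℝ (fderiv ℝ f) (z + v)) v :=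
    fun v => (hasFDerivAt_comp_add_left z).2 ((hD1.differentiable (by norm_num)) (z + v)).hasFDerivAt
  have d3 : ∀ v, HasFDerivAt (fun v => fderiv ℝ (fderiv ℝ f) (z + v))
      (fderiv ℝ (fderiv ℝ (fderiv ℝ f)) (z + v)) v :=
    fun v => (hasFDerivAt_comp_add_left z).2 ((hD2.differentiable (by norm_num)) (z + v)).hasFDerivAt
  have d4 : HasFDerivAt (fun v => fderiv ℝ (fderiv ℝ (fderiv ℝ f)) (z + v))
      (fderiv ℝ (fderiv ℝ (fderiv ℝ (fderiv ℝ f))) (z + 0)) 0 :=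
    (hasFDerivAt_comp_add_left z).2 ((hD3.differentiable (by norm_num)) (z + 0)).hasFDerivAt
  have symm3' : ∀ u v w, fderiv ℝ (fderiv ℝ (fderiv ℝ f)) z u v w =
      fderiv ℝ (fderiv ℝ (fderiv ℝ f)) z u w v := by
    intro u v w
    have h := ((hD2.differentiable (by norm_num)) z).hasFDerivAt
    have e1 := (h.clm_apply (hasFDerivAt_const v z)).clm_apply (hasFDerivAt_const w z)
    have e2 := (h.clm_apply (hasFDerivAt_const w z)).clm_apply (hasFDerivAt_const v z)
    simp only [symm2 _ w v] at e2
    simpa using DFunLike.congr_fun (e1.unique e2) u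
  generalize fderiv ℝ (fderiv ℝ (fderiv ℝ (fderiv ℝ f))) = D4 at *
  have b3 : (fun v => fderiv ℝ (fderiv ℝ (fderiv ℝ f)) (z + v)
      - fderiv ℝ (fderiv ℝ (fderiv ℝ f)) z) =O[𝓝 0] fun v => ‖v‖ ^ 1 := by
    simpa using d4.isBigO_sub.norm_right
  have b2 := isBigO_norm_pow_succ_of_hasFDerivAt_s13 (f := fun v => fderiv ℝ (fderiv ℝ f) (z + v)
      - (fderiv ℝ (fderiv ℝ f) z + fderiv ℝ (fderiv ℝ (fderiv ℝ f)) z v)) (by simp)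
      (fun v => (d3 v).sub ((ContinuousLinearMap.hasFDerivAt _).const_add _)) b3
  generalize fderiv ℝ (fderiv ℝ (fderiv ℝ f)) = D3 at *
  have b1 := isBigO_norm_pow_succ_of_hasFDerivAt_s13 (f := fun v => fderiv ℝ f (z + v)
      - (fderiv ℝ f z + fderiv ℝ (fderiv ℝ f) z v + (1 / 2 : ℝ) • D3 z v v)) (by simp)
      (fun v => (d2 v).sub ((((fderiv ℝ (fderiv ℝ f) z).hasFDerivAt).const_add _).add
        (((D3 z).hasFDerivAt.clm_apply (hasFDerivAt_id v)).const_smul (1 / 2 : ℝ))))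
      (b2.congr_left fun v => by
        ext w x
        simp [symm3 w v]
        module)
  generalize fderiv ℝ (fderiv ℝ f) = D2 at *
  refine ⟨fderiv ℝ f z, D2 z, D3 z, symm2 z, ?_⟩
  exact isBigO_norm_pow_succ_of_hasFDerivAt_s13 (by simp)
      (fun v => (d1 v).sub ((((fderiv ℝ f z).hasFDerivAt.const_add _).add
        (((D2 z).hasFDerivAt.clm_apply (hasFDerivAt_id v)).const_smul (1 / 2 : ℝ))).add
        ((((D3 z).hasFDerivAt.clm_apply (hasFDerivAt_id v)).clm_apply
          (hasFDerivAt_id v)).const_smul (1 / 6 : ℝ))))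
      (b1.congr_left fun v => by
        ext w
        simp [symm3 w v, symm2 z w v, symm3' v v w]
        module)

/-- Third-order expansion of a `C^4` map along a curve which is itself expanded to third order. -/
theorem ContDiff.exists_expansion_comp {V W : Type*} [NormedAddCommGroup V]
    [NormedSpace ℝ V] [NormedAddCommGroup W] [NormedSpace ℝ W] {f : V → W}
    (hf : ContDiff ℝ 4 f) (z : V) :
    ∃ (A : V →L[ℝ] W) (B : V →L[ℝ] V →L[ℝ] W) (T : V →L[ℝ] V →L[ℝ] V →L[ℝ] W),
      ∀ (a b c : V) (q : ℝ → V),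
        (fun h => q h - (h • a + h ^ 2 • b + h ^ 3 • c)) =O[𝓝 0] (fun h : ℝ => h ^ 4) →
        (fun h => f (z + q h) - (f z + h • A a + h ^ 2 • (A b + (1 / 2 : ℝ) • B a a) +
          h ^ 3 • (A c + B a b + (1 / 6 : ℝ) • T a a a))) =O[𝓝 0] (fun h : ℝ => h ^ 4) := by
  obtain ⟨A, B, T, hB, hT⟩ := hf.exists_taylor_three z
  refine ⟨A, B, T, fun a b c q hq => ?_⟩
  set p : ℝ → V := fun h => h • a + h ^ 2 • b + h ^ 3 • c with hp
  have hpc : Tendsto p (𝓝 0) (𝓝 0) := by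
    have : Continuous p := by fun_prop
    simpa [hp] using this.tendsto 0
  have hqc : Tendsto q (𝓝 0) (𝓝 0) := by
    have h4 : Tendsto (fun h : ℝ => h ^ 4) (𝓝 0) (𝓝 0) := by
      simpa using (continuous_pow 4).tendsto (0 : ℝ)
    have := (hq.trans_tendsto h4).add hpc
    simpa only [hp, sub_add_cancel, add_zero] using this
  have hpO : p =O[𝓝 0] fun h : ℝ => h := by
    have hr : (fun h : ℝ => a + h • b + h ^ 2 • c) =O[𝓝 0] fun _ => (1 : ℝ) :=
      (Continuous.tendsto (by fun_prop) 0).isBigO_one ℝ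
    refine ((isBigO_refl (fun h : ℝ => h) (𝓝 0)).smul hr).congr (fun h => ?_) fun h => ?_
    · simp only [hp]; module
    · simp
  have h1 : (fun h => f (z + q h) - f (z + p h)) =O[𝓝 0] fun h : ℝ => h ^ 4 := by
    have hs := (hf.contDiffAt.hasStrictFDerivAt (x := z) (by norm_num)).isBigO_sub
    have ht : Tendsto (fun h => (z + q h, z + p h)) (𝓝 0) (𝓝 (z, z)) := by
      simpa using (hqc.const_add z).prodMk_nhds (hpc.const_add z)
    exact (hs.comp_tendsto ht).trans (hq.congr_left fun h => by simp [hp])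
  have h2 := (hT.comp_tendsto hpc).trans ((hpO.norm_left).pow 4)
  have h3 : (fun h : ℝ => h ^ 4 • ((1 / 2 : ℝ) • ((2 : ℝ) • B a c + B b b + (2 * h) • B b c
      + h ^ 2 • B c c) + (1 / 6 : ℝ) •
        (T a a b + T a b a + T b a a
        + h • (T a a c + T a c a + T c a a + T a b b + T b a b + T b b a)
        + h ^ 2 • (T a b c + T a c b + T b a c + T b c a + T c a b + T c b a + T b b b)
        + h ^ 3 • (T a c c + T c a c + T c c a + T b b c + T b c b + T c b b)
        + h ^ 4 • (T b c c + T c b c + T c c b) + h ^ 5 • T c c c)))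
      =O[𝓝 0] fun h : ℝ => h ^ 4 := by
    refine ((isBigO_refl (fun h : ℝ => h ^ 4) (𝓝 0)).smul
      ((Continuous.tendsto (by fun_prop) 0).isBigO_one ℝ)).congr_right fun h => ?_
    simp
  refine ((h1.add h2).add h3).congr_left fun h => ?_
  simp only [Function.comp_apply, hp, map_add, map_smul, add_apply,
    smul_apply, hB b a, hB c a, hB c b]
  module

/-- Third-order expansion of the value of a non-autonomous vector field at the point
`(t + c * h, x + y h)`, when `y` has first-order term `h * c * F (t, x)`. -/
theorem ContDiff.exists_expansion_stage {E : Type*} [NormedAddCommGroup E] [NormedSpace ℝ E]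
    {F : ℝ × E → E} (hF : ContDiff ℝ 4 F) (t : ℝ) (x : E) :
    ∃ (α β τ : E) (L M : E →L[ℝ] E), ∀ (c : ℝ) (y₂ y₃ : E) (y : ℝ → E),
      (fun h => y h - (h • c • F (t, x) + h ^ 2 • y₂ + h ^ 3 • y₃))
        =O[𝓝 0] (fun h : ℝ => h ^ 4) →
      (fun h => F (t + c * h, x + y h) - (F (t, x) + h • c • α +
        h ^ 2 • (L y₂ + (c ^ 2 / 2) • β) + h ^ 3 • (L y₃ + c • M y₂ + (c ^ 3 / 6) • τ)))
        =O[𝓝 0] (fun h : ℝ => h ^ 4) := by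
  obtain ⟨A, B, T, hABT⟩ := hF.exists_expansion_comp (t, x)
  set a : ℝ × E := (1, F (t, x)) with ha
  refine ⟨A a, B a a, T a a a, A ∘L .inr ℝ ℝ E, B a ∘L .inr ℝ ℝ E, fun c y₂ y₃ y hy => ?_⟩
  have hq : (fun h => (c * h, y h) - (h • c • a + h ^ 2 • ((0 : ℝ), y₂) + h ^ 3 • ((0 : ℝ), y₃)))
      =O[𝓝 0] (fun h : ℝ => h ^ 4) := by
    refine ((isBigO_zero (fun h : ℝ => h ^ 4) (𝓝 0)).prod_left hy).congr_left fun h => ?_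
    ext <;> simp [ha, mul_comm]
  refine (hABT _ _ _ _ hq).congr_left fun h => ?_
  simp only [map_smul, smul_apply, ContinuousLinearMap.comp_apply,
    ContinuousLinearMap.inr_apply, Prod.mk_add_mk]
  module

/-- An approximate solution of an ordinary differential equation, with defect
`O(h ^ n)`, is `O(h ^ (n + 1))`-close to the exact solution with the same initial value. -/
theorem isBigO_sub_of_isBigO_defect {E : Type*} [NormedAddCommGroup E] [NormedSpace ℝ E]
    {F : ℝ × E → E} (hF : ContDiff ℝ 1 F) {t : ℝ} {v w w' : ℝ → E} {n : ℕ} (h0 : v 0 = w 0)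
    (hv : ∀ h, HasDerivAt v (F (t + h, v h)) h) (hw : ∀ h, HasDerivAt w (w' h) h)
    (hdef : (fun h => F (t + h, w h) - w' h) =O[𝓝 0] fun h : ℝ => h ^ n) :
    (fun h => v h - w h) =O[𝓝 0] fun h : ℝ => h ^ (n + 1) := by
  have hlip : (fun h => F (t + h, v h) - F (t + h, w h)) =O[𝓝 0] fun h => v h - w h := by
    have hs := (hF.contDiffAt.hasStrictFDerivAt (x := (t, v 0)) (by norm_num)).isBigO_sub
    have htl : Tendsto (fun h : ℝ => t + h) (𝓝 0) (𝓝 t) := by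
      simpa using (continuous_const_add t).tendsto 0
    have ht : Tendsto (fun h => ((t + h, v h), (t + h, w h))) (𝓝 0) (𝓝 ((t, v 0), (t, v 0))) :=
      (htl.prodMk_nhds (hv 0).continuousAt).prodMk_nhds
        (htl.prodMk_nhds (by simpa only [h0] using (hw 0).continuousAt.tendsto))
    refine (hs.comp_tendsto ht).trans (IsBigO.of_norm_left ?_)
    simpa [Function.comp_def, Prod.norm_def] using isBigO_refl (fun h => v h - w h) (𝓝 0)
  have main : ∀ k ≤ n + 1, (fun h => v h - w h) =O[𝓝 0] fun h : ℝ => h ^ k := by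
    intro k
    induction k with
    | zero =>
      intro _
      simpa using ((hv 0).continuousAt.sub (hw 0).continuousAt).tendsto.isBigO_one ℝ
    | succ k ih =>
      intro hk
      have hpow : (fun h : ℝ => h ^ n) =O[𝓝 0] fun h : ℝ => h ^ k := by
        rcases (Nat.succ_le_succ_iff.1 hk).eq_or_lt with rfl | hlt
        · exact isBigO_refl _ _
        · exact (isLittleO_pow_pow hlt).isBigO
      have hd : (fun h => F (t + h, v h) - w' h) =O[𝓝 0] fun h : ℝ => h ^ k :=
        ((hlip.trans (ih (by omega))).add (hdef.trans hpow)).congr_left fun h => by abel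
      have := isBigO_norm_pow_succ_of_hasFDerivAt_s13 (k := k) (f := fun h => v h - w h)
        (by simp [h0]) (fun h => ((hv h).sub (hw h)).hasFDerivAt)
        (IsBigO.of_norm_left (by simpa using hd.norm_norm))
      exact (this.congr_right (g₂ := fun h : ℝ => ‖h ^ (k + 1)‖) (by simp)).of_norm_right
  exact main _ le_rfl


/-- Local truncation error of the classical fourth-order, four-stage explicit
Runge–Kutta method (RK4) with tableau `c = (0, 1/2, 1/2, 1)`, `a₂₁ = 1/2`,
`a₃₂ = 1/2`, `a₄₃ = 1`, `b = (1/6, 1/3, 1/3, 1/6)`: one step from the exact solution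
approximates `u(t+h)` to fifth order in `h`. -/
theorem rk4_local_truncation_error {E : Type*} [NormedAddCommGroup E] [NormedSpace ℝ E]
    [CompleteSpace E] (F : ℝ × E → E) (hF : ContDiff ℝ 4 F)
    (hFbdd : ∀ i : ℕ, i ≤ 4 → ∃ M : ℝ, ∀ x : ℝ × E, ‖iteratedFDeriv ℝ i F x‖ ≤ M)
    (u : ℝ → E) (hu : ∀ s : ℝ, HasDerivAt u (F (s, u s)) s) (t : ℝ) :
    ∃ C > (0 : ℝ), ∃ h₀ > (0 : ℝ), ∀ h : ℝ, 0 < h → h ≤ h₀ →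
      ‖u (t + h) -
          (u t + h •
            (((1 : ℝ) / 6) • F (t, u t) +
             ((1 : ℝ) / 3) • F (t + h / 2, u t + (h / 2) • F (t, u t)) +
             ((1 : ℝ) / 3) • F (t + h / 2,
               u t + (h / 2) • F (t + h / 2, u t + (h / 2) • F (t, u t))) +
             ((1 : ℝ) / 6) • F (t + h,
               u t + h • F (t + h / 2,
                 u t + (h / 2) • F (t + h / 2, u t + (h / 2) • F (t, u t))))))‖
        ≤ C * h ^ 5 := by
  obtain ⟨α, β, τ, L, M, hst⟩ := hF.exists_expansion_stage t (u t)
  set f := F (t, u t)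
  set k₂ : ℝ → E := fun h => F (t + h / 2, u t + (h / 2) • f) with hk₂
  set k₃ : ℝ → E := fun h => F (t + h / 2, u t + (h / 2) • k₂ h) with hk₃
  set k₄ : ℝ → E := fun h => F (t + h, u t + h • k₃ h) with hk₄
  have smul_isBigO : ∀ {r : ℝ → E} (c : ℝ) {n : ℕ}, r =O[𝓝 0] (fun h : ℝ => h ^ n) →
      (fun h => (c * h) • r h) =O[𝓝 0] fun h : ℝ => h ^ (n + 1) := fun c n hr =>
    (((isBigO_refl (fun h : ℝ => h) (𝓝 0)).const_mul_left c).smul hr).congr_right fun h => by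
      simp [pow_succ, mul_comm]
  have pow_isBigO : (fun h : ℝ => h ^ 5) =O[𝓝 0] fun h : ℝ => h ^ 4 :=
    (isLittleO_pow_pow (by norm_num)).isBigO
  have hquartic : ∀ w : E, (fun h : ℝ => h ^ 4 • w) =O[𝓝 0] fun h : ℝ => h ^ 4 := fun w =>
    ((isBigO_refl (fun h : ℝ => h ^ 4) (𝓝 0)).smul (isBigO_const_const w one_ne_zero _)).congr_right
      (g₂ := fun h : ℝ => h ^ 4) fun h => mul_one (h ^ 4)
  have e₂ : (fun h => k₂ h - (f + h • (1 / 2 : ℝ) • α + h ^ 2 • (1 / 8 : ℝ) • β +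
      h ^ 3 • (1 / 48 : ℝ) • τ)) =O[𝓝 0] fun h : ℝ => h ^ 4 := by
    refine (hst (1 / 2) 0 0 (fun h => (h / 2) • f) ?_).congr_left fun h => ?_
    · refine (isBigO_zero _ _).congr_left fun h => ?_
      module
    · simp only [hk₂, map_zero, one_div_mul_eq_div]
      module
  have e₃ : (fun h => k₃ h - (f + h • (1 / 2 : ℝ) • α +
      h ^ 2 • ((1 / 4 : ℝ) • L α + (1 / 8 : ℝ) • β) +
      h ^ 3 • ((1 / 16 : ℝ) • L β + (1 / 8 : ℝ) • M α + (1 / 48 : ℝ) • τ)))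
      =O[𝓝 0] fun h : ℝ => h ^ 4 := by
    refine (hst (1 / 2) ((1 / 4 : ℝ) • α) ((1 / 16 : ℝ) • β)
      (fun h => (h / 2) • k₂ h) ?_).congr_left fun h => ?_
    · refine (((smul_isBigO (1 / 2) e₂).trans pow_isBigO).add
        (hquartic ((1 / 96 : ℝ) • τ))).congr_left fun h => ?_
      module
    · simp only [hk₃, map_smul, one_div_mul_eq_div]
      module
  have e₄ : (fun h => k₄ h - (f + h • α + h ^ 2 • ((1 / 2 : ℝ) • L α + (1 / 2 : ℝ) • β) +
      h ^ 3 • ((1 / 4 : ℝ) • L (L α) + (1 / 8 : ℝ) • L β + (1 / 2 : ℝ) • M α + (1 / 6 : ℝ) • τ)))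
      =O[𝓝 0] fun h : ℝ => h ^ 4 := by
    refine (hst 1 ((1 / 2 : ℝ) • α) ((1 / 4 : ℝ) • L α + (1 / 8 : ℝ) • β)
      (fun h => h • k₃ h) ?_).congr_left fun h => ?_
    · refine (((smul_isBigO 1 e₃).trans pow_isBigO).add
        (hquartic ((1 / 16 : ℝ) • L β + (1 / 8 : ℝ) • M α + (1 / 48 : ℝ) • τ))).congr_left
        fun h => ?_
      module
    · simp only [hk₄, map_add, map_smul, one_mul]
      module
  set y₃ : E := (1 / 6 : ℝ) • (L α + β) with hy₃
  set y₄ : E := (1 / 4 : ℝ) • (L y₃ + (1 / 2 : ℝ) • M α + (1 / 6 : ℝ) • τ) with hy₄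
  have exact_sol : (fun h => u (t + h) - (u t + (h • f + h ^ 2 • (1 / 2 : ℝ) • α + h ^ 3 • y₃ +
      h ^ 4 • y₄))) =O[𝓝 0] fun h : ℝ => h ^ 5 := by
    refine isBigO_sub_of_isBigO_defect (hF.of_le (by norm_num)) (t := t)
      (w' := fun h => f + (2 * h) • (1 / 2 : ℝ) • α + (3 * h ^ 2) • y₃ + (4 * h ^ 3) • y₄)
      (by simp) (fun h => (hu (t + h)).comp_const_add t h) (fun h => ?_) ?_
    · have h1 := ((hasDerivAt_id h).smul_const f).add
        ((hasDerivAt_pow 2 h).smul_const ((1 / 2 : ℝ) • α))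
      have := ((h1.add ((hasDerivAt_pow 3 h).smul_const y₃)).add
        ((hasDerivAt_pow 4 h).smul_const y₄)).const_add (u t)
      refine this.congr_deriv ?_
      norm_num
    · refine (hst 1 ((1 / 2 : ℝ) • α) y₃ (fun h => h • f + h ^ 2 • (1 / 2 : ℝ) • α + h ^ 3 • y₃ +
        h ^ 4 • y₄) ?_).congr_left fun h => ?_
      · refine (hquartic y₄).congr_left fun h => ?_
        module
      · simp only [one_mul, hy₄]
        simp only [hy₃, map_smul, map_add]
        module
  have total := exact_sol.sub (((smul_isBigO (1 / 3) e₂).add (smul_isBigO (1 / 3) e₃)).add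
    (smul_isBigO (1 / 6) e₄))
  have key : (fun h => u (t + h) - (u t + h • ((1 / 6 : ℝ) • f + (1 / 3 : ℝ) • k₂ h +
      (1 / 3 : ℝ) • k₃ h + (1 / 6 : ℝ) • k₄ h))) =O[𝓝 0] fun h : ℝ => h ^ 5 := by
    refine total.congr_left fun h => ?_
    simp only [hy₄, hy₃, map_smul, map_add]
    module
  obtain ⟨C, hC, hb⟩ := key.exists_pos
  obtain ⟨r, hr, hball⟩ := Metric.eventually_nhds_iff_ball.1 hb.bound
  refine ⟨C, hC, r / 2, by positivity, fun h hpos hle => ?_⟩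
  have := hball h (by rw [mem_ball_zero_iff, Real.norm_of_nonneg hpos.le]; linarith)
  rwa [Real.norm_of_nonneg (by positivity : (0 : ℝ) ≤ h ^ 5)] at this
end
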